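/- For a prime p ≥ 7, every supersingular p-Weil polynomial of degree 4 is one of: (X²+p)², (X²−p)², X⁴+pX²+p², X⁴−pX²+p², or X⁴+p². -/

import Mathlib

open Polynomial

/-- A supersingular `p`-Weil number in `ℂ`: `√p` times a root of unity. -/
def IsSupersingularWeilNumber (p : ℕ) (α : ℂ) : Prop :=
  IsIntegral ℤ α ∧ ∃ ζ : ℂ, (∃ n : ℕ, 0 < n ∧ ζ ^ n = 1) ∧ α = (Real.sqrt p : ℂ) * ζ

/-- A supersingular `p`-Weil polynomial: monic in `ℤ[X]`, all complex roots are
supersingular `p`-Weil numbers, and the factor `X² - p` appears with even multiplicity. -/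
def IsSupersingularWeilPolynomial (p : ℕ) (f : ℤ[X]) : Prop :=
  f.Monic ∧
  (∀ z : ℂ, (f.map (Int.castRingHom ℂ)).IsRoot z → IsSupersingularWeilNumber p z) ∧
  (∃ k : ℕ, (X ^ 2 - C (p : ℤ)) ^ (2 * k) ∣ f ∧ ¬ (X ^ 2 - C (p : ℤ)) ^ (2 * k + 1) ∣ f)

theorem Int.dvd_of_isIntegral_of_eq_mul {m n : ℤ} {x : ℂ} (hn : n ≠ 0) (hx : IsIntegral ℤ x)
    (h : (m : ℂ) = n * x) : n ∣ m := by
  have hn' : (n : ℂ) ≠ 0 := Int.cast_ne_zero.mpr hn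
  have hq : x = algebraMap ℚ ℂ (m / n) := by
    rw [map_div₀, map_intCast, map_intCast, h, mul_div_cancel_left₀ _ hn']
  rw [hq, isIntegral_algebraMap_iff (algebraMap ℚ ℂ).injective,
    IsIntegrallyClosed.isIntegral_iff] at hx
  obtain ⟨k, hk⟩ := hx
  refine ⟨k, ?_⟩
  rw [hq, ← hk, ← IsScalarTower.algebraMap_apply] at h
  simp only [eq_intCast] at h
  exact_mod_cast h

theorem Polynomial.Monic.eq_of_natDegree_eq_four {R : Type*} [Semiring R] {f : R[X]}
    (hf : f.Monic) (hdeg : f.natDegree = 4) :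
    f = X ^ 4 + C (f.coeff 3) * X ^ 3 + C (f.coeff 2) * X ^ 2 + C (f.coeff 1) * X
      + C (f.coeff 0) := by
  have h4 : f.coeff 4 = 1 := by rw [← hdeg]; exact hf
  conv_lhs => rw [f.as_sum_range_C_mul_X_pow, hdeg]
  simp only [Finset.sum_range_succ, Finset.sum_range_zero, h4, map_one, one_mul, pow_zero,
    mul_one, pow_one, zero_add]
  abel

/-- Vieta's formulas for a monic quartic over an algebraically closed field. -/
theorem Polynomial.Monic.exists_roots_of_natDegree_eq_four {K : Type*} [Field K]
    [IsAlgClosed K] {g : K[X]} (hg : g.Monic) (hdeg : g.natDegree = 4) :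
    ∃ w x y z : K, (g.IsRoot w ∧ g.IsRoot x ∧ g.IsRoot y ∧ g.IsRoot z) ∧
      g.coeff 3 = -(w + x + y + z) ∧
      g.coeff 2 = w * x + w * y + w * z + x * y + x * z + y * z ∧
      g.coeff 1 = -(w * x * y + w * x * z + w * y * z + x * y * z) ∧
      g.coeff 0 = w * x * y * z := by
  have hs := IsAlgClosed.splits g
  obtain ⟨w, x, y, z, h⟩ := Multiset.card_eq_four.mp (hs.natDegree_eq_card_roots.symm.trans hdeg)
  have hroot : ∀ r ∈ g.roots, g.IsRoot r := fun r hr => isRoot_of_mem_roots hr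
  have hprod := hs.eq_prod_roots_of_monic hg
  rw [h] at hroot
  have hexp : g = X ^ 4 + C (-(w + x + y + z)) * X ^ 3
      + C (w * x + w * y + w * z + x * y + x * z + y * z) * X ^ 2
      + C (-(w * x * y + w * x * z + w * y * z + x * y * z)) * X + C (w * x * y * z) := by
    conv_lhs => rw [hprod, h]
    simp only [Multiset.insert_eq_cons, Multiset.map_cons, Multiset.prod_cons,
      Multiset.map_singleton, Multiset.prod_singleton, map_neg, map_add, map_mul]
    ring
  refine ⟨w, x, y, z, ⟨hroot _ (by simp), hroot _ (by simp), hroot _ (by simp),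
    hroot _ (by simp)⟩, ?_, ?_, ?_, ?_⟩ <;>
  · conv_lhs => rw [hexp]
    simp [coeff_X, coeff_C, coeff_X_pow, -map_add, -map_neg, -map_mul]

theorem mul_conj_eq_one_of_pow_eq_one {ζ : ℂ} {n : ℕ} (hn : 0 < n) (h : ζ ^ n = 1) :
    ζ * starRingEnd ℂ ζ = 1 := by
  rw [Complex.mul_conj, Complex.normSq_eq_norm_sq, Complex.norm_eq_one_of_pow_eq_one h hn.ne']
  simp

namespace IsSupersingularWeilNumber

variable {p : ℕ} {α : ℂ}

theorem mul_conj (h : IsSupersingularWeilNumber p α) : α * starRingEnd ℂ α = p := by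
  obtain ⟨-, ζ, ⟨n, hn, hζ⟩, rfl⟩ := h
  have hs : (Real.sqrt p : ℂ) * Real.sqrt p = p := by
    exact_mod_cast Real.mul_self_sqrt p.cast_nonneg
  rw [map_mul, Complex.conj_ofReal]
  linear_combination ζ * starRingEnd ℂ ζ * hs + p * mul_conj_eq_one_of_pow_eq_one hn hζ

theorem exists_isIntegral (h : IsSupersingularWeilNumber p α) :
    ∃ ζ : ℂ, IsIntegral ℤ ζ ∧ α = (Real.sqrt p : ℂ) * ζ := by
  obtain ⟨-, ζ, ⟨n, hn, hζ⟩, rfl⟩ := h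
  exact ⟨ζ, IsIntegral.of_pow hn (hζ ▸ isIntegral_one), rfl⟩

theorem re_sq_le (h : IsSupersingularWeilNumber p α) : α.re ^ 2 ≤ p := by
  have := h.mul_conj
  rw [Complex.mul_conj] at this
  have h2 : Complex.normSq α = p := by exact_mod_cast this
  rw [Complex.normSq_apply] at h2
  nlinarith [sq_nonneg α.im]

/-- The trace `α + conj α` of a root of a self-reciprocal quartic satisfies a quadratic equation. -/
theorem re_quadratic (h : IsSupersingularWeilNumber p α) (hp : p ≠ 0) {a b : ℤ}
    (hroot : α ^ 4 + a * α ^ 3 + b * α ^ 2 + p * a * α + (p : ℂ) ^ 2 = 0) :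
    4 * α.re ^ 2 + 2 * a * α.re + (b - 2 * p) = 0 := by
  have hm := h.mul_conj
  have hα : α ≠ 0 := by
    rintro rfl
    simp [hp, eq_comm] at hm
  have ht : α + starRingEnd ℂ α = (2 * α.re : ℝ) := Complex.add_conj α
  have key : α ^ 2 * ((α + starRingEnd ℂ α) ^ 2 + a * (α + starRingEnd ℂ α) + (b - 2 * p)) = 0 := by
    linear_combination hroot + (2 * α ^ 2 + α * starRingEnd ℂ α + p + a * α) * hm
  have := (mul_eq_zero.mp key).resolve_left (pow_ne_zero 2 hα)
  rw [ht] at this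
  have h' : (2 * α.re) ^ 2 + a * (2 * α.re) + ((b : ℝ) - 2 * p) = 0 := by exact_mod_cast this
  linear_combination h'

end IsSupersingularWeilNumber

/-- Four real solutions of a quadratic equation whose sum is twice the sum of its roots contain
both of its roots. -/
theorem exists_both_roots_of_quadratic {p a b : ℝ} {r : Fin 4 → ℝ} (hle : ∀ i, r i ^ 2 ≤ p)
    (hq : ∀ i, 4 * r i ^ 2 + 2 * a * r i + b = 0) (hsum : a = -(r 0 + r 1 + r 2 + r 3)) :
    ∃ x y : ℝ, x ^ 2 ≤ p ∧ y ^ 2 ≤ p ∧ a = -2 * (x + y) ∧ b = 4 * x * y := by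
  by_cases h : ∀ i, r i = r 0
  · have ha : a = -2 * (r 0 + r 0) := by rw [hsum, h 1, h 2, h 3]; ring
    exact ⟨r 0, r 0, hle 0, hle 0, ha, by linear_combination hq 0 - 2 * r 0 * ha⟩
  · push Not at h
    obtain ⟨i, hi⟩ := h
    have ha : a = -2 * (r i + r 0) := by
      refine mul_left_cancel₀ (sub_ne_zero.mpr hi) ?_
      linear_combination (hq i - hq 0) / 2
    exact ⟨r i, r 0, hle i, hle 0, ha, by linear_combination hq 0 - 2 * r 0 * ha⟩

theorem coeff_bounds {p : ℕ} (hp : p.Prime) (hp7 : 7 ≤ p) {a b : ℤ} {x y : ℝ}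
    (hx : x ^ 2 ≤ p) (hy : y ^ 2 ≤ p) (ha : (p * a : ℝ) = -2 * (x + y))
    (hb : (p * b - 2 * p : ℝ) = 4 * x * y) : a = 0 ∧ -2 ≤ b ∧ b ≤ 2 := by
  have hp0 : (0 : ℝ) < p := by exact_mod_cast hp.pos
  have hpa : (p : ℤ) * a ^ 2 ≤ 16 := by
    have : (p : ℝ) * (p * a ^ 2) ≤ p * 16 := by
      have : (p * a : ℝ) ^ 2 = 4 * (x + y) ^ 2 := by rw [ha]; ring
      nlinarith [sq_nonneg (x - y)]
    exact_mod_cast le_of_mul_le_mul_left this hp0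
  have ha0 : a = 0 := by
    by_contra hne
    have ha1 : 0 < a ^ 2 := by positivity
    have ha2 : a ^ 2 ≤ 2 := by
      have : (7 : ℤ) ≤ p := by exact_mod_cast hp7
      nlinarith
    have hap : (a : ℝ) = 1 ∨ (a : ℝ) = -1 := by
      have h1 : a ≤ 1 := by nlinarith
      have h2 : -1 ≤ a := by nlinarith
      have : a = 1 ∨ a = -1 := by omega
      exact_mod_cast this
    have hdisc : 4 * (b - 2) ≤ (p : ℤ) := by
      have : (p : ℝ) * (4 * (b - 2)) ≤ p * p := by
        rcases hap with h | h <;> rw [h] at ha <;> nlinarith [sq_nonneg (x - y)]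
      exact_mod_cast le_of_mul_le_mul_left this hp0
    have hs := Real.sqrt_nonneg (p : ℝ)
    have hs2 := Real.sq_sqrt hp0.le
    have hx' := abs_le.mp (Real.abs_le_sqrt hx)
    have hy' := abs_le.mp (Real.abs_le_sqrt hy)
    set s := Real.sqrt (p : ℝ)
    have hlow : 2 * s ≤ b + 2 := by
      refine le_of_mul_le_mul_left ?_ hp0
      rcases hap with h | h <;> rw [h] at ha
      · nlinarith [mul_nonneg (by linarith : 0 ≤ s + x) (by linarith : 0 ≤ s + y)]
      · nlinarith [mul_nonneg (by linarith : 0 ≤ s - x) (by linarith : 0 ≤ s - y)]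
    have hb0 : 0 ≤ b + 2 := by
      have : (0 : ℝ) ≤ b + 2 := by linarith
      exact_mod_cast this
    have hsq : 4 * (p : ℤ) ≤ (b + 2) ^ 2 := by
      have : 4 * (p : ℝ) ≤ (b + 2) ^ 2 := by nlinarith
      exact_mod_cast this
    have hp16 : p ≤ 16 := by
      have : (p : ℤ) ≤ 16 := by nlinarith
      exact_mod_cast this
    have hb6 : b ≤ 6 := by omega
    have hb2 : -2 ≤ b := by omega
    interval_cases p <;> first | (norm_num at hp; done) | (push_cast at *; interval_cases b <;> omega)
  subst ha0
  have hyx : y = -x := by push_cast at ha; linarith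
  subst hyx
  have h1 : (p : ℝ) * (-2) ≤ p * b := by nlinarith
  have h2 : (p : ℝ) * b ≤ p * 2 := by nlinarith [sq_nonneg x]
  exact ⟨rfl, by exact_mod_cast le_of_mul_le_mul_left h1 hp0,
    by exact_mod_cast le_of_mul_le_mul_left h2 hp0⟩

theorem not_isSupersingularWeilPolynomial_X_sq_sub_mul {p : ℕ} (hp : 0 < p) (a : ℤ) :
    ¬ IsSupersingularWeilPolynomial p ((X ^ 2 - C (p : ℤ)) * (X ^ 2 + C a * X + C (p : ℤ))) := by
  rintro ⟨-, -, k, hk, hk'⟩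
  rcases k with _ | k
  · exact hk' (by simp)
  have hmonic : (X ^ 2 - C (p : ℤ)).Monic := monic_X_pow_sub_C _ two_ne_zero
  have h2 := (pow_dvd_pow (X ^ 2 - C (p : ℤ)) (show 2 ≤ 2 * (k + 1) by omega)).trans hk
  rw [pow_two, mul_dvd_mul_iff_left hmonic.ne_zero] at h2
  obtain ⟨q, hq⟩ := h2
  have hp0 : (0 : ℝ) < p := by exact_mod_cast hp
  have hs2 := Real.sq_sqrt hp0.le
  have h₁ := congrArg (aeval (Real.sqrt p)) hq
  have h₂ := congrArg (aeval (-Real.sqrt p)) hq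
  simp [hs2] at h₁ h₂
  linarith

/-- The coefficients of a supersingular `p`-Weil quartic. -/
theorem IsSupersingularWeilPolynomial.exists_eq {p : ℕ} (hp : p.Prime) (hp7 : 7 ≤ p) {f : ℤ[X]}
    (hdeg : f.natDegree = 4) (hf : IsSupersingularWeilPolynomial p f) :
    ∃ b : ℤ, -2 ≤ b ∧ b ≤ 2 ∧ f = X ^ 4 + C (p * b) * X ^ 2 + C ((p : ℤ) ^ 2) := by
  have hp0 : (p : ℤ) ≠ 0 := by exact_mod_cast hp.ne_zero
  have hpC : (p : ℂ) ≠ 0 := by exact_mod_cast hp.ne_zero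
  have hfeq := hf.1.eq_of_natDegree_eq_four hdeg
  obtain ⟨w, x, y, z, ⟨hw, hx, hy, hz⟩, h3, h2, h1, h0⟩ :=
    (hf.1.map (Int.castRingHom ℂ)).exists_roots_of_natDegree_eq_four
      ((hf.1.natDegree_map _).trans hdeg)
  simp only [coeff_map, eq_intCast] at h3 h2 h1 h0
  generalize f.coeff 3 = a at *
  generalize f.coeff 2 = b at *
  generalize f.coeff 1 = c at *
  generalize f.coeff 0 = d at *
  have Hw := hf.2.1 w hw
  have Hx := hf.2.1 x hx
  have Hy := hf.2.1 y hy
  have Hz := hf.2.1 z hz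
  have cw := Hw.mul_conj
  have cx := Hx.mul_conj
  have cy := Hy.mul_conj
  have cz := Hz.mul_conj
  have h3' := congrArg (starRingEnd ℂ) h3
  have h2' := congrArg (starRingEnd ℂ) h2
  have h0' := congrArg (starRingEnd ℂ) h0
  simp only [map_neg, map_add, map_mul, map_intCast] at h3' h2' h0'
  have hc : (p : ℤ) * c = d * a := by
    have : (p : ℂ) * c = d * a := by
      rw [h3', h0, h1]
      linear_combination x * y * z * cw + w * y * z * cx + w * x * z * cy + w * x * y * cz
    exact_mod_cast this
  have hd : d ^ 2 = ((p : ℤ) ^ 2) ^ 2 := by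
    have : (d : ℂ) ^ 2 = ((p : ℂ) ^ 2) ^ 2 := by
      calc (d : ℂ) ^ 2 = (w * starRingEnd ℂ w) * (x * starRingEnd ℂ x) * (y * starRingEnd ℂ y)
            * (z * starRingEnd ℂ z) := by rw [sq]; nth_rw 1 [h0]; rw [h0']; ring
        _ = _ := by rw [cw, cx, cy, cz]; ring
    exact_mod_cast this
  rcases sq_eq_sq_iff_eq_or_eq_neg.mp hd with rfl | rfl
  · obtain rfl : c = p * a := mul_left_cancel₀ hp0 (by rw [hc]; ring)
    have hs : (Real.sqrt p : ℂ) * Real.sqrt p = p := by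
      exact_mod_cast Real.mul_self_sqrt p.cast_nonneg
    obtain ⟨u₁, hu₁, e₁⟩ := Hw.exists_isIntegral
    obtain ⟨u₂, hu₂, e₂⟩ := Hx.exists_isIntegral
    obtain ⟨u₃, hu₃, e₃⟩ := Hy.exists_isIntegral
    obtain ⟨u₄, hu₄, e₄⟩ := Hz.exists_isIntegral
    have hpa : (p : ℤ) ∣ a := by
      refine (Nat.prime_iff_prime_int.mp hp).dvd_of_dvd_pow (n := 2)
        (Int.dvd_of_isIntegral_of_eq_mul hp0 ((((hu₁.add hu₂).add hu₃).add hu₄).pow 2) ?_)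
      push_cast
      rw [h3, e₁, e₂, e₃, e₄]
      linear_combination (u₁ + u₂ + u₃ + u₄) ^ 2 * hs
    have hpb : (p : ℤ) ∣ b := by
      refine Int.dvd_of_isIntegral_of_eq_mul hp0
        ((((((hu₁.mul hu₂).add (hu₁.mul hu₃)).add (hu₁.mul hu₄)).add (hu₂.mul hu₃)).add
          (hu₂.mul hu₄)).add (hu₃.mul hu₄)) ?_
      push_cast
      rw [h2, e₁, e₂, e₃, e₄]
      linear_combination (u₁ * u₂ + u₁ * u₃ + u₁ * u₄ + u₂ * u₃ + u₂ * u₄ + u₃ * u₄) * hs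
    obtain ⟨a, rfl⟩ := hpa
    obtain ⟨b, rfl⟩ := hpb
    have heval : ∀ r : ℂ, (f.map (Int.castRingHom ℂ)).IsRoot r →
        r ^ 4 + (p * a : ℤ) * r ^ 3 + (p * b : ℤ) * r ^ 2 + p * (p * a : ℤ) * r + (p : ℂ) ^ 2
          = 0 := by
      intro r hr
      rw [IsRoot, hfeq] at hr
      simpa using hr
    have hsum := congrArg Complex.re h3
    obtain ⟨u, v, hu, hv, huv, huv'⟩ := exists_both_roots_of_quadratic (p := p)
      (a := (p * a : ℤ)) (b := (p * b : ℤ) - 2 * p) (r := ![w.re, x.re, y.re, z.re])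
      (by simp [Fin.forall_fin_succ, Hw.re_sq_le, Hx.re_sq_le, Hy.re_sq_le, Hz.re_sq_le])
      (by
        have q := fun {r : ℂ} (h : IsSupersingularWeilNumber p r) hr =>
          h.re_quadratic hp.ne_zero (heval r hr)
        intro i
        fin_cases i
        exacts [q Hw hw, q Hx hx, q Hy hy, q Hz hz])
      (by simpa using hsum)
    push_cast at huv huv'
    obtain ⟨rfl, hb, hb'⟩ := coeff_bounds hp hp7 hu hv huv huv'
    exact ⟨b, hb, hb', by simpa using hfeq⟩
  · exfalso
    obtain rfl : c = -(p * a) := mul_left_cancel₀ hp0 (by rw [hc]; ring)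
    obtain rfl : b = 0 := by
      have hb : (p : ℂ) ^ 2 * b = -(p : ℂ) ^ 2 * b := by
        have hd' : -(p : ℂ) ^ 2 = w * x * y * z := by rw [← h0]; push_cast; ring
        linear_combination (p : ℂ) ^ 2 * h2 - w * x * y * z * h2' - b * hd'
          -(y * z) * (x * starRingEnd ℂ x * cw + p * cx)
          - x * z * (y * starRingEnd ℂ y * cw + p * cy)
          - x * y * (z * starRingEnd ℂ z * cw + p * cz)
          - w * z * (y * starRingEnd ℂ y * cx + p * cy)
          - w * y * (z * starRingEnd ℂ z * cx + p * cz)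
          - w * x * (z * starRingEnd ℂ z * cy + p * cz)
      have : (2 * (p : ℂ) ^ 2) * b = 0 := by linear_combination hb
      exact_mod_cast (mul_eq_zero.mp this).resolve_left (by simp [hpC])
    refine not_isSupersingularWeilPolynomial_X_sq_sub_mul hp.pos a ?_
    convert hf using 1
    rw [hfeq]
    simp only [map_neg, map_mul, map_pow, map_zero]
    ring

theorem stmt0 (p : ℕ) (hp : p.Prime) (hp7 : 7 ≤ p) (f : ℤ[X])
    (hdeg : f.natDegree = 4) (hf : IsSupersingularWeilPolynomial p f) :
    f = (X ^ 2 + C (p : ℤ)) ^ 2 ∨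
    f = (X ^ 2 - C (p : ℤ)) ^ 2 ∨
    f = X ^ 4 + C (p : ℤ) * X ^ 2 + C ((p : ℤ) ^ 2) ∨
    f = X ^ 4 - C (p : ℤ) * X ^ 2 + C ((p : ℤ) ^ 2) ∨
    f = X ^ 4 + C ((p : ℤ) ^ 2) := by
  obtain ⟨b, hb, hb', rfl⟩ := hf.exists_eq hp hp7 hdeg
  interval_cases b
  · exact .inr (.inl (by simp only [map_mul, map_pow, map_neg, C_ofNat]; ring))
  · exact .inr (.inr (.inr (.inl (by simp only [map_mul, map_pow, map_neg, map_one]; ring))))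
  · exact .inr (.inr (.inr (.inr (by simp))))
  · exact .inr (.inr (.inl (by simp)))
  · exact .inl (by simp only [map_mul, map_pow, C_ofNat]; ring)
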